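/- For 0 ≤ z < 1 and parameters a, b with b > 0 and 2b not a nonpositive integer, the quadratic transformation ₂F₁(a, a − b + 1/2; b + 1/2; z²) = (1+z)^{−2a} ₂F₁(a, b; 2b; 4z/(1+z)²) holds. -/

import Mathlib

/-- Pochhammer symbol `(a)_k`. -/
noncomputable def poch (a : ℝ) (k : ℕ) : ℝ := ∏ i ∈ Finset.range k, (a + i)

/-- Gauss hypergeometric function `₂F₁(a,b;c;z)` as a power series. -/
noncomputable def hyp2F1 (a b c z : ℝ) : ℝ :=
  ∑' k : ℕ, poch a k * poch b k / poch c k * z ^ k / (k.factorial : ℝ)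

noncomputable def hco (a b c : ℝ) (n : ℕ) : ℝ :=
  poch a n * poch b n / poch c n / (n.factorial : ℝ)

theorem HasSum.congr_fun0 {f g : ℕ → ℝ} {s : ℝ} (h : HasSum g s) (e : ∀ n, f n = g n) :
    HasSum f s := by
  rw [funext e]; exact h

theorem poch_succ' (a : ℝ) (n : ℕ) : poch a (n+1) = poch a n * (a + n) := by
  simp [poch, Finset.prod_range_succ]

theorem poch_succ_left (a : ℝ) (n : ℕ) : poch a (n+1) = a * poch (a+1) n := by
  simp only [poch, Finset.prod_range_succ']
  rw [mul_comm]
  congr 1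
  · simp
  · apply Finset.prod_congr rfl
    intro i _
    push_cast; ring

theorem poch_pos {c : ℝ} (hc : 0 < c) (n : ℕ) : 0 < poch c n := by
  apply Finset.prod_pos
  intro i _
  positivity

theorem hco_rec (a b : ℝ) {c : ℝ} (hc : 0 < c) (n : ℕ) :
    ((n:ℝ)+1) * (c + n) * hco a b c (n+1) = (a+n)*(b+n)*hco a b c n := by
  have h1 := (poch_pos hc n).ne'
  have h2 : c + n ≠ 0 := by positivity
  have h3 : (n.factorial : ℝ) ≠ 0 := by positivity
  have h4 : (n:ℝ)+1 ≠ 0 := by positivity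
  simp only [hco, poch_succ', Nat.factorial_succ]
  push_cast
  field_simp

theorem hco_shift (a b : ℝ) {c : ℝ} (hc : 0 < c) (n : ℕ) :
    ((n:ℝ)+1) * hco a b c (n+1) = a*b/c * hco (a+1) (b+1) (c+1) n := by
  have h1 := (poch_pos (show 0 < c+1 by positivity) n).ne'
  have h3 : (n.factorial : ℝ) ≠ 0 := by positivity
  have h4 : (n:ℝ)+1 ≠ 0 := by positivity
  simp only [hco, poch_succ_left, Nat.factorial_succ]
  push_cast
  field_simp

theorem hco_summable (a b : ℝ) {c : ℝ} (hc : 0 < c) {x : ℝ} (hx : |x| < 1) :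
    Summable (fun n => hco a b c n * x^n) := by
  obtain ⟨r, hr1, hr2⟩ := exists_between hx
  apply summable_of_ratio_norm_eventually_le hr2
  have key : ∀ d : ℝ, Filter.Tendsto (fun n : ℕ => (d + n) / ((n:ℝ)+1)) Filter.atTop (nhds 1) := by
    intro d
    have h := (tendsto_one_div_add_atTop_nhds_zero_nat (𝕜 := ℝ)).const_mul (d-1)
    have h2 := h.const_add 1
    simp only [mul_zero, add_zero] at h2
    refine h2.congr ?_
    intro n
    have : (n:ℝ)+1 ≠ 0 := by positivity
    field_simp
    ring
  have h := ((((key a).mul (key b)).div (key c) one_ne_zero).mul_const x).abs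
  simp only [mul_one, div_one, one_mul] at h
  filter_upwards [h.eventually (gt_mem_nhds hr1)] with n hn
  have h2 : c + n ≠ 0 := by positivity
  have h4 : (n:ℝ)+1 ≠ 0 := by positivity
  have e : hco a b c (n+1) * x^(n+1) =
      ((a + n) / ((n:ℝ)+1) * ((b + n) / ((n:ℝ)+1)) / ((c + n) / ((n:ℝ)+1)) * x) * (hco a b c n * x^n) := by
    have := hco_rec a b hc n
    have e2 : hco a b c (n+1) = (a+n)*(b+n)*hco a b c n / (((n:ℝ)+1) * (c + n)) := by
      rw [← this]; field_simp
    rw [e2, pow_succ]; field_simp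
  rw [e, norm_mul]
  gcongr
  exact hn.le

theorem hyp_eq (a b c x : ℝ) : hyp2F1 a b c x = ∑' n, hco a b c n * x^n := by
  unfold hyp2F1 hco
  congr 1; ext n; ring

theorem hyp_hasSum (a b : ℝ) {c : ℝ} (hc : 0 < c) {x : ℝ} (hx : |x| < 1) :
    HasSum (fun n => hco a b c n * x^n) (hyp2F1 a b c x) := by
  rw [hyp_eq]; exact (hco_summable a b hc hx).hasSum

/-- first derivative -/
noncomputable def hypD (a b c x : ℝ) : ℝ := a*b/c * hyp2F1 (a+1) (b+1) (c+1) x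

theorem hypD_hasSum (a b : ℝ) {c : ℝ} (hc : 0 < c) {x : ℝ} (hx : |x| < 1) :
    HasSum (fun n : ℕ => ((n:ℝ)+1) * hco a b c (n+1) * x^n) (hypD a b c x) := by
  have := (hyp_hasSum (a+1) (b+1) (show 0 < c+1 by positivity) hx).mul_left (a*b/c)
  have e : (fun n : ℕ => ((n:ℝ)+1) * hco a b c (n+1) * x^n) =
      fun n => a*b/c * (hco (a+1) (b+1) (c+1) n * x^n) := by
    ext n
    rw [hco_shift a b hc]; ring
  rw [e]; exact this

theorem hasSum_shift {u : ℕ → ℝ} {x S : ℝ}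
    (h : HasSum (fun n : ℕ => ((n:ℝ)+1) * u (n+1) * x^n) S) :
    HasSum (fun n : ℕ => (n:ℝ) * u n * x^n) (x * S) := by
  rw [← hasSum_nat_add_iff' 1]
  simp only [Finset.range_one, Finset.sum_singleton, Nat.cast_zero, zero_mul, sub_zero]
  refine HasSum.congr_fun0 (h.mul_left x) fun n => ?_
  push_cast; ring

theorem hyp_hasDerivAt (a b : ℝ) {c : ℝ} (hc : 0 < c) {x : ℝ} (hx : |x| < 1) :
    HasDerivAt (hyp2F1 a b c) (hypD a b c x) x := by
  obtain ⟨r, hr1, hr2⟩ := exists_between hx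
  have hr0 : 0 < r := lt_of_le_of_lt (abs_nonneg x) hr1
  have hs : Summable (fun n : ℕ => |(n:ℝ) * hco a b c n * r^n|) := 
    (hasSum_shift (hypD_hasSum a b hc (x := r) (by rwa [abs_of_pos hr0]))).summable.abs
  have hs2 := hs.mul_left r⁻¹
  have H := hasDerivAt_tsum_of_isPreconnected (𝕜 := ℝ) (F := ℝ)
    (g := fun n y => hco a b c n * y^n)
    (g' := fun n y => hco a b c n * ((n:ℝ) * y^(n-1))) (t := Metric.ball 0 r) (y₀ := 0) (y := x) hs2
    Metric.isOpen_ball (convex_ball (0:ℝ) r).isPreconnected ?_ ?_ (by simpa using hr0) 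
    (hco_summable a b hc (by simp)) (by simpa using hr1)
  · have e : hyp2F1 a b c = fun z => ∑' n, hco a b c n * z^n := by
      ext z; exact hyp_eq ..
    rw [e]
    refine H.congr_deriv ?_
    have h3 := hypD_hasSum a b hc hx
    apply HasSum.tsum_eq
    rw [← hasSum_nat_add_iff' 1]
    simp only [Finset.range_one, Finset.sum_singleton, Nat.cast_zero, zero_mul, mul_zero, sub_zero]
    refine HasSum.congr_fun0 (h3) fun n => ?_
    push_cast
    ring
  · intro n y _
    exact (hasDerivAt_pow n y).const_mul _
  · intro n y hy
    have hy' : |y| < r := by simpa using hy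
    rcases n with _ | n
    · simp
    · simp only [Nat.add_sub_cancel, Real.norm_eq_abs, abs_mul, abs_pow, abs_of_pos hr0]
      have : r⁻¹ * (|((n+1:ℕ):ℝ)| * |hco a b c (n+1)| * r^(n+1)) = |hco a b c (n+1)| * (|((n+1:ℕ):ℝ)| * r^n) := by
        rw [pow_succ]; field_simp
      rw [this]
      gcongr

noncomputable def hypDD (a b c x : ℝ) : ℝ := a*b/c * hypD (a+1) (b+1) (c+1) x

theorem hypD_hasDerivAt (a b : ℝ) {c : ℝ} (hc : 0 < c) {x : ℝ} (hx : |x| < 1) :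
    HasDerivAt (hypD a b c) (hypDD a b c x) x :=
  (hyp_hasDerivAt (a+1) (b+1) (show 0 < c+1 by positivity) hx).const_mul _

theorem hyp_ode (a b : ℝ) {c : ℝ} (hc : 0 < c) {x : ℝ} (hx : |x| < 1) :
    x*(1-x)*hypDD a b c x + (c-(a+b+1)*x)*hypD a b c x - a*b*hyp2F1 a b c x = 0 := by
  have h0 := hyp_hasSum a b hc hx
  have h1 := hypD_hasSum a b hc hx
  have h2 : HasSum (fun n : ℕ => ((n:ℝ)+1) * (((n+1:ℕ):ℝ)+1) * hco a b c (n+2) * x^n) (hypDD a b c x) := by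
    have := (hypD_hasSum (a+1) (b+1) (show 0 < c+1 by positivity) hx).mul_left (a*b/c)
    refine HasSum.congr_fun0 (this) fun n => ?_
    have := hco_shift a b hc (n+1)
    push_cast at this ⊢
    linear_combination ((n:ℝ)+1) * x^n * this
  have h3 := hasSum_shift h1
  have h4 : HasSum (fun n : ℕ => (n:ℝ) * (((n:ℝ)+1) * hco a b c (n+1)) * x^n) (x * hypDD a b c x) := by
    apply hasSum_shift (u := fun n => ((n:ℝ)+1) * hco a b c (n+1))
    refine HasSum.congr_fun0 (h2) fun n => ?_
    push_cast; ring
  have h5 : HasSum (fun n : ℕ => (n:ℝ) * (((n:ℝ)-1) * hco a b c n) * x^n) (x * (x * hypDD a b c x)) := by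
    apply hasSum_shift (u := fun n => ((n:ℝ)-1) * hco a b c n)
    refine HasSum.congr_fun0 (h4) fun n => ?_
    push_cast; ring
  have hA := h4.add (h1.mul_left c)
  have hB := (h5.add (h3.mul_left (a+b+1))).add (h0.mul_left (a*b))
  have : x * hypDD a b c x + c * hypD a b c x = x * (x * hypDD a b c x) + (a+b+1)*(x*hypD a b c x) + a*b*hyp2F1 a b c x := by
    refine hA.unique ?_
    refine HasSum.congr_fun0 (hB) fun n => ?_
    linear_combination x^n * hco_rec a b hc n
  linear_combination this

theorem uniq (f g g' : ℝ → ℝ) (w K : ℝ) (hw : 0 < w)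
    (hf : ∀ z ∈ Set.Icc 0 w, HasDerivAt f (g z) z)
    (hg : ∀ z ∈ Set.Icc 0 w, HasDerivAt g (g' z) z)
    (f0 : f 0 = 0) (g0 : g 0 = 0)
    (H : ∀ z ∈ Set.Ioo 0 w, g z * g' z ≤ K * (f z^2 + g z^2)) : f w = 0 := by
  have hd : ∀ z ∈ Set.Icc 0 w, HasDerivAt (fun z => Real.exp (-(2*K+1)*z) * (f z^2+g z^2))
      (Real.exp (-(2*K+1)*z) * (-(2*K+1)*(f z^2+g z^2) + (2*f z*g z + 2*g z*g' z))) z := by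
    intro z hz
    have h1 : HasDerivAt (fun z => Real.exp (-(2*K+1)*z)) (Real.exp (-(2*K+1)*z) * (-(2*K+1))) z := by
      simpa using ((hasDerivAt_id z).const_mul (-(2*K+1))).exp
    refine HasDerivAt.congr_deriv (h1.mul (((hf z hz).pow 2).add ((hg z hz).pow 2))) ?_
    simp
    ring
  have anti : AntitoneOn (fun z => Real.exp (-(2*K+1)*z) * (f z^2+g z^2)) (Set.Icc 0 w) := by
    apply antitoneOn_of_deriv_nonpos (convex_Icc 0 w)
    · intro z hz; exact (hd z hz).continuousAt.continuousWithinAt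
    · intro z hz
      rw [interior_Icc] at hz
      exact (hd z (Set.Ioo_subset_Icc_self hz)).differentiableAt.differentiableWithinAt
    · intro z hz
      rw [interior_Icc] at hz
      rw [(hd z (Set.Ioo_subset_Icc_self hz)).deriv]
      apply mul_nonpos_of_nonneg_of_nonpos (Real.exp_pos _).le
      nlinarith [H z hz, sq_nonneg (f z - g z)]
  have h := anti (Set.left_mem_Icc.2 hw.le) (Set.right_mem_Icc.2 hw.le) hw.le
  simp only [f0, g0] at h
  have hp := Real.exp_pos (-(2*K+1)*w)
  have : f w^2 + g w^2 ≤ 0 := by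
    by_contra hc
    push Not at hc
    have := mul_pos hp hc
    norm_num at h
    norm_num at this
    linarith
  nlinarith [sq_nonneg (f w), sq_nonneg (g w)]

theorem ineq (a b z t f g g' : ℝ) (hb : 0 < b) (hp : 0 < t) (htz : t < z) (hz1 : z < 1)
    (o : t*(1-t^2)*g' + (2*b-(4*a-2*b+2)*t^2) * g - 4*a*(a-b+1/2)*t*f = 0) :
    g * g' ≤ (|4*a-4*b+2| + |4*a*(a-b+1/2)|)/(1-z^2) * (f^2+g^2) := by
  have hm : 0 < 1 - z^2 := by nlinarith
  have hmt : 1 - z^2 ≤ 1 - t^2 := by nlinarith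
  have hmt0 : 0 < 1 - t^2 := by linarith
  have e : g * g' = - (2*b/t) * g^2 + ((4*a-4*b+2)*t*g^2 + 4*a*(a-b+1/2)*(f*g))/(1-t^2) := by
    have e1 : g' = ((4*a-2*b+2)*t^2-2*b) * g /(t*(1-t^2)) + 4*a*(a-b+1/2)*t*f/(t*(1-t^2)) := by
      rw [← add_div, eq_div_iff (by positivity)]
      linear_combination o
    rw [e1]
    have := hmt0.ne'
    generalize hs : 1 - t^2 = s at *
    field_simp
    rw [← hs]
    ring
  have i1 : 0 ≤ (2*b/t) * g^2 := by positivity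
  have i2 : (4*a-4*b+2)*t*g^2 ≤ |4*a-4*b+2| * (f^2+g^2) := by
    generalize 4*a-4*b+2 = k
    have h1 : k*t ≤ |k| := by
      calc k*t ≤ |k| * t := mul_le_mul_of_nonneg_right (le_abs_self k) hp.le
        _ ≤ |k| * 1 := mul_le_mul_of_nonneg_left (by linarith) (abs_nonneg k)
        _ = |k| := mul_one _
    have h2 := mul_le_mul_of_nonneg_right h1 (sq_nonneg g)
    have h3 := mul_nonneg (abs_nonneg k) (sq_nonneg f)
    linarith
  have i3 : 4*a*(a-b+1/2)*(f*g) ≤ |4*a*(a-b+1/2)| * (f^2+g^2) := by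
    refine (le_abs_self _).trans ?_
    rw [abs_mul (4*a*(a-b+1/2))]
    gcongr
    rw [abs_le]
    constructor <;> nlinarith [sq_nonneg (f - g), sq_nonneg (f + g)]
  have i4 : ((4*a-4*b+2)*t*g^2 + 4*a*(a-b+1/2)*(f*g))/(1-t^2) ≤
      ((|4*a-4*b+2| + |4*a*(a-b+1/2)|) * (f^2+g^2))/(1-z^2) := by
    gcongr
    linarith
  rw [e, div_mul_eq_mul_div]
  linarith

theorem hyp_zero (a b c : ℝ) : hyp2F1 a b c 0 = 1 := by
  rw [hyp_eq, tsum_eq_single 0]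
  · simp [hco, poch]
  · intro n hn; simp [hn]

set_option maxHeartbeats 1000000 in
theorem hyp2F1_quadratic_transform (a b z : ℝ) (hb : 0 < b)
    (hb' : ∀ n : ℕ, 2 * b ≠ -(n : ℝ)) (hz0 : 0 ≤ z) (hz1 : z < 1) :
    hyp2F1 a (a - b + 1/2) (b + 1/2) (z ^ 2) =
      (1 + z) ^ (-(2 * a)) * hyp2F1 a b (2 * b) (4 * z / (1 + z) ^ 2) := by
  rcases hz0.eq_or_lt with h0 | hzp
  · subst h0; simp [hyp_zero]
  have hc1 : 0 < b + 1/2 := by positivity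
  have hc2 : 0 < 2*b := by positivity
  set F := hyp2F1 a (a - b + 1/2) (b + 1/2) with hF
  set F1 := hypD a (a - b + 1/2) (b + 1/2) with hF1
  set F2 := hypDD a (a - b + 1/2) (b + 1/2) with hF2
  set G := hyp2F1 a b (2*b) with hG
  set G1 := hypD a b (2*b) with hG1
  set G2 := hypDD a b (2*b) with hG2
  let y : ℝ → ℝ := fun z => 4 * z / (1 + z)^2
  let y1 : ℝ → ℝ := fun z => 4 * (1-z) / (1 + z)^3
  let y2 : ℝ → ℝ := fun z => (8*z-16) / (1 + z)^4
  let p : ℝ → ℝ := fun z => (1+z)^(-(2*a))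
  let f : ℝ → ℝ := fun t => F (t^2) - p t * G (y t)
  let q : ℝ → ℝ := fun t => -(2*a)/(1+t) * G (y t) + y1 t * G1 (y t)
  let g : ℝ → ℝ := fun t => 2*t*F1 (t^2) - p t * q t
  let g' : ℝ → ℝ := fun t => 2*F1 (t^2) + 4*t^2*F2 (t^2) - p t * (-(2*a)/(1+t) * q t +
    ((2*a)/(1+t)^2 * G (y t) - (2*a)/(1+t) * (y1 t * G1 (y t)) + y2 t * G1 (y t) + y1 t^2 * G2 (y t)))
  have hsq : ∀ t : ℝ, 0 ≤ t → t < 1 → |t^2| < 1 := by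
    intro t h0 h1
    rw [abs_of_nonneg (by positivity)]; nlinarith
  have hy : ∀ t : ℝ, 0 ≤ t → t < 1 → |y t| < 1 := by
    intro t h0 h1
    have : 0 < 1 + t := by positivity
    have : 0 ≤ y t := by positivity
    rw [abs_of_nonneg this]
    simp only [y]
    rw [div_lt_one (by positivity)]
    nlinarith [mul_pos (sub_pos.2 h1) (sub_pos.2 h1)]
  have dy : ∀ t : ℝ, 0 ≤ t → HasDerivAt y (y1 t) t := by
    intro t h0
    have ht : 1 + t ≠ 0 := by positivity
    have := ((hasDerivAt_id t).const_mul 4).div (((hasDerivAt_id t).const_add 1).pow 2) (pow_ne_zero 2 ht)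
    refine this.congr_deriv ?_
    simp only [y1, id]
    simp
    field_simp
    ring
  have dy1 : ∀ t : ℝ, 0 ≤ t → HasDerivAt y1 (y2 t) t := by
    intro t h0
    have ht : 1 + t ≠ 0 := by positivity
    have := (((hasDerivAt_id t).const_sub 1).const_mul 4).div (((hasDerivAt_id t).const_add 1).pow 3) (pow_ne_zero 3 ht)
    refine this.congr_deriv ?_
    simp only [y2, id]
    simp
    field_simp
    ring
  have dp : ∀ t : ℝ, 0 ≤ t → HasDerivAt p (p t * (-(2*a)/(1+t))) t := by
    intro t h0
    have ht : 0 < 1 + t := by positivity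
    have := ((hasDerivAt_id t).const_add 1).rpow_const (p := -(2*a)) (Or.inl ht.ne')
    refine this.congr_deriv ?_
    simp only [p, id]
    rw [Real.rpow_sub_one ht.ne']
    field_simp
  have dG : ∀ t : ℝ, 0 ≤ t → t < 1 → HasDerivAt (fun t => G (y t)) (G1 (y t) * y1 t) t := by
    intro t h0 h1
    exact (hyp_hasDerivAt a b hc2 (hy t h0 h1)).comp t (dy t h0)
  have dG1 : ∀ t : ℝ, 0 ≤ t → t < 1 → HasDerivAt (fun t => G1 (y t)) (G2 (y t) * y1 t) t := by
    intro t h0 h1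
    exact (hypD_hasDerivAt a b hc2 (hy t h0 h1)).comp t (dy t h0)
  have ds : ∀ t : ℝ, HasDerivAt (fun t : ℝ => t^2) (2*t) t := by
    intro t; simpa using hasDerivAt_pow 2 t
  have dF : ∀ t : ℝ, 0 ≤ t → t < 1 → HasDerivAt (fun t => F (t^2)) (F1 (t^2) * (2*t)) t := by
    intro t h0 h1
    exact HasDerivAt.comp (h := fun t : ℝ => t^2) t (hyp_hasDerivAt _ _ hc1 (hsq t h0 h1)) (ds t)
  have dF1 : ∀ t : ℝ, 0 ≤ t → t < 1 → HasDerivAt (fun t => F1 (t^2)) (F2 (t^2) * (2*t)) t := by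
    intro t h0 h1
    exact HasDerivAt.comp (h := fun t : ℝ => t^2) t (hypD_hasDerivAt _ _ hc1 (hsq t h0 h1)) (ds t)
  have df : ∀ t : ℝ, 0 ≤ t → t < 1 → HasDerivAt f (g t) t := by
    intro t h0 h1
    refine HasDerivAt.congr_deriv ((dF t h0 h1).sub ((dp t h0).mul (dG t h0 h1))) ?_
    simp only [g, q]; ring
  have dr : ∀ t : ℝ, 0 ≤ t → HasDerivAt (fun t : ℝ => -(2*a)/(1+t)) ((2*a)/(1+t)^2) t := by
    intro t h0
    have ht : 1 + t ≠ 0 := by positivity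
    refine HasDerivAt.congr_deriv ((hasDerivAt_const t (-(2*a))).div ((hasDerivAt_id t).const_add 1) ht) ?_
    simp
  have dg : ∀ t : ℝ, 0 ≤ t → t < 1 → HasDerivAt g (g' t) t := by
    intro t h0 h1
    have dq := ((dr t h0).mul (dG t h0 h1)).add ((dy1 t h0).mul (dG1 t h0 h1))
    refine HasDerivAt.congr_deriv ((((hasDerivAt_id t).const_mul 2).mul (dF1 t h0 h1)).sub ((dp t h0).mul dq)) ?_
    simp only [g', q, id, Pi.add_apply, Pi.mul_apply]; ring
  have ode : ∀ t : ℝ, 0 < t → t < 1 → t*(1-t^2)*g' t + (2*b-(4*a-2*b+2)*t^2) * g t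
      - 4*a*(a-b+1/2)*t*f t = 0 := by
    intro t h0 h1
    have o1 := hyp_ode a (a-b+1/2) hc1 (hsq t h0.le h1)
    have o2 := hyp_ode a b hc2 (hy t h0.le h1)
    rw [← hF, ← hF1, ← hF2] at o1
    rw [← hG, ← hG1, ← hG2] at o2
    have ht : 1 + t ≠ 0 := by positivity
    have ht' : 1 - t ≠ 0 := by linarith
    simp only [f, g, g', q]
    generalize F (t^2) = A0 at *
    generalize F1 (t^2) = A1 at *
    generalize F2 (t^2) = A2 at *
    generalize G (y t) = B0 at *
    generalize G1 (y t) = B1 at *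
    generalize G2 (y t) = B2 at *
    generalize p t = P at *
    simp only [y] at o2
    simp only [y1, y2]
    linear_combination (norm := (field_simp; ring)) 4*t*o1 - P*(4*(1-t)/(1+t))*o2
  have key := uniq f g g' z ((|4*a-4*b+2| + |4*a*(a-b+1/2)|)/(1-z^2)) hzp
    (fun t ht => df t ht.1 (ht.2.trans_lt hz1)) (fun t ht => dg t ht.1 (ht.2.trans_lt hz1))
    (by simp [f, y, p, hF, hG, hyp_zero])
    (by
      simp [g, y, p, q, y1, hG, hG1, hypD, hyp_zero]
      field_simp
      ring)
    (by
      intro t ht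
      exact ineq a b z t _ _ _ hb ht.1 ht.2 hz1 (ode t ht.1 (ht.2.trans hz1)))
  have : F (z^2) - p z * G (y z) = 0 := key
  exact sub_eq_zero.1 this
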